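/- arXiv:2511.13435 — 19 statements merged into one kernel-verified Lean document; each statement's English description precedes it below -/
import Mathlib

section
/- Let M be a monoid and let S(M) be its special semidirect product. An element (A, e) of S(M) is idempotent if and only if e is an idempotent of M and eA ⊆ A. Moreover, the set of all idempotents of S(M) is a semilattice (i.e. it is closed under the multiplication of S(M) and any two idempotents of S(M) commute) if and only if 1 is the unique idempotent of M. -/
open Pointwise

/-- The special semidirect product `S(M) = P(M) ⋊ M`. -/
structure SSP (M : Type*) [Monoid M] where
  carrier : Set M
  elt : M

namespace SSP

variable {M : Type*} [Monoid M]

instance : Mul (SSP M) :=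
  ⟨fun s t => ⟨s.carrier ∪ s.elt • t.carrier, s.elt * t.elt⟩⟩

instance : One (SSP M) := ⟨⟨∅, 1⟩⟩

theorem mul_def (s t : SSP M) :
    s * t = ⟨s.carrier ∪ s.elt • t.carrier, s.elt * t.elt⟩ := rfl

theorem one_def : (1 : SSP M) = ⟨∅, 1⟩ := rfl

instance instMonoid : Monoid (SSP M) where
  mul_assoc s t u := by
    simp only [mul_def, mk.injEq]
    constructor
    · rw [mul_smul, Set.smul_set_union, Set.union_assoc]
    · exact mul_assoc _ _ _
  one_mul s := by
    cases s
    simp [mul_def, one_def]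
  mul_one s := by
    cases s
    simp [mul_def, one_def]

end SSP

section Defs

variable {N : Type*} [Monoid N]

/-- `a⁻¹A = {u ∈ M : au ∈ A}`. -/
def preSet {M : Type*} [Monoid M] (a : M) (A : Set M) : Set M := {u | a * u ∈ A}

/-- `a R* b` iff `ua = va ⇔ ub = vb` for all `u, v`. -/
def RStarRel (a b : N) : Prop := ∀ u v : N, u * a = v * a ↔ u * b = v * b

/-- `a L* b` iff `au = av ⇔ bu = bv` for all `u, v`. -/
def LStarRel (a b : N) : Prop := ∀ u v : N, a * u = a * v ↔ b * u = b * v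

/-- `a R̃_E b` iff `a` and `b` have the same idempotent left identities in `E`. -/
def RTilde (E : Set N) (a b : N) : Prop := {e ∈ E | e * a = a} = {e ∈ E | e * b = b}

/-- `a L̃_E b` iff `a` and `b` have the same idempotent right identities in `E`. -/
def LTilde (E : Set N) (a b : N) : Prop := {e ∈ E | a * e = a} = {e ∈ E | b * e = b}

/-- The principal right ideal `aN`. -/
def rIdeal (a : N) : Set N := {x | ∃ m : N, x = a * m}

/-- The principal left ideal `Na`. -/
def lIdeal (a : N) : Set N := {x | ∃ m : N, x = m * a}

/-- A monoid is left abundant if every `R*`-class contains an idempotent. -/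
def LeftAbundant (N : Type*) [Monoid N] : Prop :=
  ∀ a : N, ∃ e : N, IsIdempotentElem e ∧ RStarRel a e

/-- A monoid is right abundant if every `L*`-class contains an idempotent. -/
def RightAbundant (N : Type*) [Monoid N] : Prop :=
  ∀ a : N, ∃ e : N, IsIdempotentElem e ∧ LStarRel a e

/-- Condition (R). -/
def CondR (N : Type*) [Monoid N] : Prop :=
  ∀ a b : N, ∃ X : Set (N × N), X.Finite ∧ (∀ p ∈ X, a * p.1 = b * p.2) ∧
    ∀ u v : N, a * u = b * v ↔ ∃ p ∈ X, ∃ m : N, u = p.1 * m ∧ v = p.2 * m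

/-- Condition (L). -/
def CondL (N : Type*) [Monoid N] : Prop :=
  ∀ a b : N, ∃ X : Set (N × N), X.Finite ∧ (∀ p ∈ X, p.1 * a = p.2 * b) ∧
    ∀ u v : N, u * a = v * b ↔ ∃ p ∈ X, ∃ m : N, u = m * p.1 ∧ v = m * p.2

/-- Right ideal Howson monoid. -/
def RightIdealHowson (N : Type*) [Monoid N] : Prop :=
  ∀ a b : N, ∃ F : Set N, F.Finite ∧ rIdeal a ∩ rIdeal b = ⋃ f ∈ F, rIdeal f

/-- Left ideal Howson monoid. -/
def LeftIdealHowson (N : Type*) [Monoid N] : Prop :=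
  ∀ a b : N, ∃ F : Set N, F.Finite ∧ lIdeal a ∩ lIdeal b = ⋃ f ∈ F, lIdeal f

/-- Principally right ideal Howson monoid. -/
def PrincipallyRightIdealHowson (N : Type*) [Monoid N] : Prop :=
  ∀ a b : N, (rIdeal a ∩ rIdeal b).Nonempty → ∃ u : N, rIdeal a ∩ rIdeal b = rIdeal u

/-- Principally left ideal Howson monoid. -/
def PrincipallyLeftIdealHowson (N : Type*) [Monoid N] : Prop :=
  ∀ a b : N, (lIdeal a ∩ lIdeal b).Nonempty → ∃ u : N, lIdeal a ∩ lIdeal b = lIdeal u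

/-- Strongly right ideal Howson monoid. -/
def StronglyRightIdealHowson (N : Type*) [Monoid N] : Prop :=
  ∀ a b : N, (rIdeal a ∩ rIdeal b).Nonempty →
    ∃ (n : ℕ) (u : Fin n → N), 1 ≤ n ∧ (∀ i, u i ∈ rIdeal a ∩ rIdeal b) ∧
      (rIdeal a ∩ rIdeal b = ⋃ i, rIdeal (u i)) ∧
      (∀ i, ((rIdeal a ∩ rIdeal b) \ rIdeal (u i)).Finite)

/-- A finite left co-ordinate system for `a, b` with respect to `A, B`. -/
def LeftCoordSystem {M : Type*} [Monoid M] (a b : M) (A B : Set M) (C : Set (M × M)) : Prop :=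
  C.Finite ∧ C ⊆ {pq : M × M | pq.1 * a = pq.2 * b} ∧
    ∀ x y : M, x * a = y * b → ∃ t : M, ∃ pq ∈ C,
      x * a = t * pq.1 * a ∧ (t * pq.1) • A ∪ (t * pq.2) • B ⊆ x • A ∪ y • B

/-- A left co-ordinated monoid. -/
def LeftCoordinated (M : Type*) [Monoid M] : Prop :=
  ∀ (a b : M) (A B : Set M), ∃ C : Set (M × M), LeftCoordSystem a b A B C

/-- A left 1-co-ordinated monoid. -/
def Left1Coordinated (M : Type*) [Monoid M] : Prop :=
  ∀ (a b : M) (A B : Set M), ∃ C : Set (M × M), LeftCoordSystem a b A B C ∧ C.Subsingleton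

/-- A right congruence: an equivalence relation compatible with right multiplication. -/
def IsRightCong (r : N → N → Prop) : Prop :=
  Equivalence r ∧ ∀ a b c : N, r a b → r (a * c) (b * c)

/-- A left congruence: an equivalence relation compatible with left multiplication. -/
def IsLeftCong (r : N → N → Prop) : Prop :=
  Equivalence r ∧ ∀ a b c : N, r a b → r (c * a) (c * b)

/-- The right congruence generated by a set of pairs. -/
def rightCongGen (W : Set (N × N)) : N → N → Prop :=
  fun a b => ∀ r : N → N → Prop, IsRightCong r → (∀ p ∈ W, r p.1 p.2) → r a b

/-- The left congruence generated by a set of pairs. -/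
def leftCongGen (W : Set (N × N)) : N → N → Prop :=
  fun a b => ∀ r : N → N → Prop, IsLeftCong r → (∀ p ∈ W, r p.1 p.2) → r a b

/-- The right annihilator congruence `r(s)`. -/
def rAnn (s : N) : N → N → Prop := fun u v => s * u = s * v

/-- The left annihilator congruence `l(s)`. -/
def lAnn (s : N) : N → N → Prop := fun u v => u * s = v * s

/-- Finitely right equated monoid. -/
def FinitelyRightEquated (N : Type*) [Monoid N] : Prop :=
  ∀ s : N, ∃ W : Set (N × N), W.Finite ∧ rAnn s = rightCongGen W

/-- Finitely left equated monoid. -/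
def FinitelyLeftEquated (N : Type*) [Monoid N] : Prop :=
  ∀ s : N, ∃ W : Set (N × N), W.Finite ∧ lAnn s = leftCongGen W

/-- An indecomposable element: its only factors are `1` and itself. -/
def Indecomposable (b : N) : Prop :=
  ∀ u v : N, b = u * v → (u = 1 ∨ u = b) ∧ (v = 1 ∨ v = b)

end Defs

/-- `(A, e)` is idempotent iff `e` is idempotent and `eA ⊆ A`. -/
theorem SSP.isIdempotentElem_mk_iff {M : Type*} [Monoid M] (A : Set M) (e : M) :
    IsIdempotentElem (SSP.mk A e) ↔ IsIdempotentElem e ∧ e • A ⊆ A := by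
  simp only [IsIdempotentElem, SSP.mul_def, SSP.mk.injEq, Set.union_eq_left]
  exact and_comm

theorem stmt0 (M : Type*) [Monoid M] :
    (∀ (A : Set M) (e : M),
      IsIdempotentElem (SSP.mk A e) ↔ IsIdempotentElem e ∧ e • A ⊆ A) ∧
    ((∀ s t : SSP M, IsIdempotentElem s → IsIdempotentElem t →
        IsIdempotentElem (s * t) ∧ s * t = t * s) ↔
      ∀ e : M, IsIdempotentElem e → e = 1) := by
  refine ⟨SSP.isIdempotentElem_mk_iff, fun h e he => ?_, fun h => ?_⟩
  · have hcomm := (h ⟨∅, e⟩ ⟨{1}, 1⟩ ((SSP.isIdempotentElem_mk_iff _ _).2 ⟨he, by simp⟩)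
      ((SSP.isIdempotentElem_mk_iff _ _).2 ⟨IsIdempotentElem.one, by simp⟩)).2
    simpa [SSP.mul_def] using hcomm
  · rintro ⟨A, e⟩ ⟨B, f⟩ hs ht
    obtain rfl := h e ((SSP.isIdempotentElem_mk_iff A e).1 hs).1
    obtain rfl := h f ((SSP.isIdempotentElem_mk_iff B f).1 ht).1
    simp [SSP.mul_def, SSP.isIdempotentElem_mk_iff, IsIdempotentElem.one, Set.union_comm]
end

section
/- Let M be a monoid. The special semidirect product S(M) is a regular monoid (i.e. for every s ∈ S(M) there exists t ∈ S(M) with s = sts) if and only if M is a group. Moreover, when M is a group, S(M) is an inverse monoid (every element has a unique inverse) in which the inverse of (X, x) is (x⁻¹X, x⁻¹), where x⁻¹X = {x⁻¹u : u ∈ X}. -/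
open Pointwise

universe u

namespace SSP

theorem exists_inverse_of_regular {M : Type*} [Monoid M]
    (h : ∀ s : SSP M, ∃ t : SSP M, s = s * t * s) (x : M) :
    ∃ y : M, x * y = 1 ∧ y * x = 1 := by
  have exists_right_inv (x : M) : ∃ y : M, x * y = 1 := by
    obtain ⟨⟨Y, y⟩, ht⟩ := h ⟨{1}, x⟩
    have hmem : x * y ∈ ({1} : Set M) := by
      rw [show ({1} : Set M) = _ from congrArg carrier ht]
      simp [mul_def]
    exact ⟨y, hmem⟩
  obtain ⟨y, hxy⟩ := exists_right_inv x
  obtain ⟨z, hyz⟩ := exists_right_inv y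
  exact ⟨y, hxy, by rwa [left_inv_eq_right_inv hxy hyz]⟩

theorem regular_of_exists_inverse {M : Type*} [Monoid M]
    (h : ∀ x : M, ∃ y : M, x * y = 1 ∧ y * x = 1) (s : SSP M) :
    ∃ t : SSP M, s = s * t * s := by
  obtain ⟨X, x⟩ := s
  obtain ⟨y, hxy, -⟩ := h x
  exact ⟨⟨y • X, y⟩, by simp [mul_def, smul_smul, hxy]⟩

theorem eq_of_inverse {G : Type*} [Group G] (X : Set G) (x : G) (t : SSP G)
    (hs : mk X x = mk X x * t * mk X x) (ht : t = t * mk X x * t) :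
    t = mk (x⁻¹ • X) x⁻¹ := by
  obtain ⟨Y, y⟩ := t
  simp only [mul_def, mk.injEq] at hs ht ⊢
  obtain ⟨hX, hx⟩ := hs
  have hy : y = x⁻¹ := eq_inv_of_mul_eq_one_right (right_eq_mul.mp hx)
  subst hy
  refine ⟨Set.Subset.antisymm ?_ ?_, rfl⟩
  · rw [Set.subset_smul_set_iff, inv_inv, hX]
    exact Set.subset_union_right.trans Set.subset_union_left
  · rw [ht.1]
    exact Set.subset_union_right.trans Set.subset_union_left

end SSP

theorem stmt1 :
    (∀ (M : Type u) [Monoid M],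
        (∀ s : SSP M, ∃ t : SSP M, s = s * t * s) ↔
          ∀ x : M, ∃ y : M, x * y = 1 ∧ y * x = 1) ∧
    (∀ (G : Type u) [Group G] (X : Set G) (x : G),
        (SSP.mk X x = SSP.mk X x * SSP.mk (x⁻¹ • X) x⁻¹ * SSP.mk X x ∧
          SSP.mk (x⁻¹ • X) x⁻¹ =
            SSP.mk (x⁻¹ • X) x⁻¹ * SSP.mk X x * SSP.mk (x⁻¹ • X) x⁻¹) ∧
        ∀ t : SSP G,
          SSP.mk X x = SSP.mk X x * t * SSP.mk X x → t = t * SSP.mk X x * t →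
            t = SSP.mk (x⁻¹ • X) x⁻¹) := by
  refine ⟨fun M _ => ⟨SSP.exists_inverse_of_regular, SSP.regular_of_exists_inverse⟩,
    fun G _ X x => ⟨⟨?_, ?_⟩, SSP.eq_of_inverse X x⟩⟩
  · simp [SSP.mul_def]
  · simp [SSP.mul_def]
end

section
/- Let M be a monoid and (A, a), (B, b) ∈ S(M). Then (A, a) and (B, b) are R*-related in S(M) if and only if A = B and a and b are R*-related in M. -/
open Pointwise

theorem RStarRel.symm {N : Type*} [Monoid N] {a b : N} (h : RStarRel a b) : RStarRel b a :=
  fun u v => (h u v).symm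

namespace SSP

variable {M : Type*} [Monoid M] {A B : Set M} {a b : M}

theorem mk_mul_mk (X Y : Set M) (x y : M) :
    (mk X x * mk Y y : SSP M) = mk (X ∪ x • Y) (x * y) := rfl

/-- The idempotent `(A, 1)` is a left identity of `(A, a)`, hence of `(B, b)`. -/
theorem subset_of_rStarRel (h : RStarRel (mk A a) (mk B b)) : A ⊆ B := by
  have hA : mk A 1 * mk A a = mk ∅ 1 * mk A a := by simp [mk_mul_mk]
  simpa [mk_mul_mk] using (h _ _).mp hA

theorem mul_eq_mul_of_rStarRel (h : RStarRel (mk A a) (mk A b)) {u v : M}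
    (huv : u * a = v * a) : u * b = v * b := by
  have hA : mk (u • A ∪ v • A) u * mk A a = mk (u • A ∪ v • A) v * mk A a := by
    simp only [mk_mul_mk, mk.injEq]
    exact ⟨by grind, huv⟩
  exact congrArg elt ((h _ _).mp hA)

end SSP

theorem stmt2 (M : Type*) [Monoid M] (A B : Set M) (a b : M) :
    RStarRel (SSP.mk A a) (SSP.mk B b) ↔ A = B ∧ RStarRel a b := by
  constructor
  · intro h
    obtain rfl : A = B :=
      (SSP.subset_of_rStarRel h).antisymm (SSP.subset_of_rStarRel h.symm)
    exact ⟨rfl, fun u v =>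
      ⟨SSP.mul_eq_mul_of_rStarRel h, SSP.mul_eq_mul_of_rStarRel h.symm⟩⟩
  · rintro ⟨rfl, h⟩ ⟨U, u⟩ ⟨V, v⟩
    simp only [SSP.mk_mul_mk, SSP.mk.injEq, h u v]
end

section
/- Let M be a monoid and let E = {(F, 1) : F ⊆ M} be the semilattice of idempotents of S(M) with second coordinate 1. The relations R* and R̃_E on S(M) are equal if and only if M is right cancellative. -/
open Pointwise

theorem SSP.mul_eq_mul_iff {M : Type*} [Monoid M] (u v s : SSP M) :
    u * s = v * s ↔ u.carrier ∪ u.elt • s.carrier = v.carrier ∪ v.elt • s.carrier ∧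
      u.elt * s.elt = v.elt * s.elt := by
  simp only [SSP.mul_def, SSP.mk.injEq]

theorem SSP.mul_eq_self_iff {M : Type*} [Monoid M] {e : SSP M} (he : e.elt = 1) (s : SSP M) :
    e * s = s ↔ e.carrier ⊆ s.carrier := by
  cases s
  simp [SSP.mul_def, he]

theorem SSP.rTilde_iff {M : Type*} [Monoid M] (s t : SSP M) :
    RTilde {u : SSP M | u.elt = 1} s t ↔ s.carrier = t.carrier := by
  constructor
  · intro h
    have key (F : Set M) : F ⊆ s.carrier ↔ F ⊆ t.carrier := by
      have := Set.ext_iff.mp h ⟨F, 1⟩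
      simpa [SSP.mul_eq_self_iff] using this
    exact ((key _).mp subset_rfl).antisymm ((key _).mpr subset_rfl)
  · intro h
    ext e
    refine and_congr_right fun he => ?_
    rw [SSP.mul_eq_self_iff he, SSP.mul_eq_self_iff he, h]

theorem RStarRel.rTilde {N : Type*} [Monoid N] {a b : N} (h : RStarRel a b) (E : Set N) :
    RTilde E a b := by
  ext e
  refine and_congr_right fun _ => ?_
  simpa using h e 1

theorem stmt3 (M : Type*) [Monoid M] :
    (∀ s t : SSP M, RStarRel s t ↔ RTilde {u : SSP M | u.elt = 1} s t) ↔
      ∀ u v a : M, u * a = v * a → u = v := by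
  constructor
  · intro h u v a huv
    have hR := (h ⟨∅, a⟩ ⟨∅, 1⟩).mpr ((SSP.rTilde_iff _ _).mpr rfl) ⟨∅, u⟩ ⟨∅, v⟩
    simpa [SSP.mul_eq_mul_iff, huv] using hR
  · intro hc s t
    refine ⟨fun h => h.rTilde _, fun h u v => ?_⟩
    have cancel (a : M) : u.elt * a = v.elt * a ↔ u.elt = v.elt :=
      ⟨hc _ _ _, fun h => by rw [h]⟩
    rw [SSP.mul_eq_mul_iff, SSP.mul_eq_mul_iff, (SSP.rTilde_iff s t).mp h, cancel, cancel]
end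

section
/- Let M be a monoid. The special semidirect product S(M) is left abundant if and only if for each subset A ⊆ M and each a ∈ M there exists an idempotent e ∈ M with eA ⊆ A such that a and e are R*-related in M. -/
open Pointwise

theorem stmt4 (M : Type*) [Monoid M] :
    LeftAbundant (SSP M) ↔
      ∀ (A : Set M) (a : M), ∃ e : M, IsIdempotentElem e ∧ e • A ⊆ A ∧ RStarRel a e := by
  constructor
  · intro h A a
    obtain ⟨⟨B, e⟩, he, hR⟩ := h ⟨A, a⟩
    refine ⟨e, congrArg SSP.elt he, ?_, fun u v => ?_⟩
    · have hA : (⟨B, e⟩ : SSP M) * ⟨A, a⟩ = 1 * ⟨A, a⟩ :=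
        (hR _ _).2 (he.trans (one_mul _).symm)
      rw [one_mul] at hA
      exact Set.subset_union_right.trans (congrArg SSP.carrier hA).subset
    · simpa [SSP.mul_def] using hR ⟨Set.univ, u⟩ ⟨Set.univ, v⟩
  · rintro h ⟨A, a⟩
    obtain ⟨e, he, hA, hR⟩ := h A a
    refine ⟨⟨A, e⟩, ?_, fun u v => ?_⟩
    · simp only [IsIdempotentElem, SSP.mul_def, SSP.mk.injEq]
      exact ⟨Set.union_eq_self_of_subset_right hA, he⟩
    · simp only [SSP.mul_def, SSP.mk.injEq, hR u.elt v.elt]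
end

section
/- Let M be a monoid and (A, a), (B, b) ∈ S(M). Then (A, a) and (B, b) are L*-related in S(M) if and only if a⁻¹A = b⁻¹B and a and b are L*-related in M. -/
open Pointwise

theorem SSP.mk_mul_eq_mk_mul_iff {M : Type*} [Monoid M] (A : Set M) (a : M) (s t : SSP M) :
    SSP.mk A a * s = SSP.mk A a * t ↔
      A ∪ a • s.carrier = A ∪ a • t.carrier ∧ a * s.elt = a * t.elt := by
  simp only [SSP.mul_def, SSP.mk.injEq]

theorem union_smul_subset_union_smul_iff {M : Type*} [Monoid M] (A X Y : Set M) (a : M) :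
    A ∪ a • X ⊆ A ∪ a • Y ↔ ∀ x ∈ X, x ∈ preSet a A ∨ ∃ y ∈ Y, a * y = a * x := by
  simp only [Set.union_subset_iff, Set.subset_union_left, true_and]
  constructor
  · exact fun h x hx => h (Set.smul_mem_smul_set hx)
  · rintro h _ ⟨x, hx, rfl⟩
    exact h x hx

theorem stmt5 (M : Type*) [Monoid M] (A B : Set M) (a b : M) :
    LStarRel (SSP.mk A a) (SSP.mk B b) ↔ preSet a A = preSet b B ∧ LStarRel a b := by
  constructor
  · intro h
    refine ⟨Set.ext fun u => ?_, fun u v => ?_⟩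
    · simpa [SSP.mk_mul_eq_mk_mul_iff, preSet] using h ⟨{u}, 1⟩ ⟨∅, 1⟩
    · simpa [SSP.mk_mul_eq_mk_mul_iff] using h ⟨∅, u⟩ ⟨∅, v⟩
  · rintro ⟨hpre, hab⟩ s t
    simp only [SSP.mk_mul_eq_mk_mul_iff, Set.Subset.antisymm_iff,
      union_smul_subset_union_smul_iff, hpre, hab _ _]
end

section
/- Let M be a monoid. The special semidirect product S(M) is right abundant if and only if M is right abundant. -/
open Pointwise

/-- Left multiplication by an `L*`-related element preserves the inclusion that governs equality of
first components in `S(M)`. -/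
theorem LStarRel.union_smul_subset_iff {M : Type*} [Monoid M] {a e : M} (h : LStarRel a e)
    (A U V : Set M) :
    A ∪ a • U ⊆ A ∪ a • V ↔ e • preSet a A ∪ e • U ⊆ e • preSet a A ∪ e • V := by
  have mem_iff (u : M) : e * u ∈ e • preSet a A ↔ a * u ∈ A := by
    constructor
    · rintro ⟨w, hw, hwu⟩
      have hwu' : a * w = a * u := (h w u).2 hwu
      exact hwu' ▸ hw
    · exact fun hu => ⟨u, hu, rfl⟩
  have mem_smul_iff (u : M) : a * u ∈ a • V ↔ e * u ∈ e • V := by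
    simp only [Set.mem_smul_set, smul_eq_mul, h _ u]
  rw [Set.union_subset_iff, Set.union_subset_iff,
    and_iff_right Set.subset_union_left, and_iff_right Set.subset_union_left]
  simp only [Set.subset_def, Set.mem_smul_set, forall_exists_index, and_imp,
    forall_apply_eq_imp_iff₂, smul_eq_mul, Set.mem_union] at mem_iff mem_smul_iff ⊢
  simp only [mem_iff, mem_smul_iff]

/-- If `a L* e` then `(A, a) L* (e(a⁻¹A), e)` in `S(M)`. -/
theorem LStarRel.ssp {M : Type*} [Monoid M] {a e : M} (h : LStarRel a e) (A : Set M) :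
    LStarRel (⟨A, a⟩ : SSP M) ⟨e • preSet a A, e⟩ := by
  rintro ⟨U, u⟩ ⟨V, v⟩
  simp only [SSP.mul_def, SSP.mk.injEq, Set.Subset.antisymm_iff, h.union_smul_subset_iff, h u v]

theorem IsIdempotentElem.ssp {M : Type*} [Monoid M] {e : M} (he : IsIdempotentElem e)
    (B : Set M) : IsIdempotentElem (⟨e • B, e⟩ : SSP M) := by
  simp only [IsIdempotentElem, SSP.mul_def, smul_smul, he.eq, Set.union_self]

theorem IsIdempotentElem.ssp_elt {M : Type*} [Monoid M] {s : SSP M} (hs : IsIdempotentElem s) :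
    IsIdempotentElem s.elt :=
  congrArg SSP.elt hs

theorem LStarRel.ssp_elt {M : Type*} [Monoid M] {s t : SSP M} (h : LStarRel s t) :
    LStarRel s.elt t.elt := by
  intro u v
  simpa [SSP.mul_def] using h ⟨∅, u⟩ ⟨∅, v⟩

theorem stmt6 (M : Type*) [Monoid M] :
    RightAbundant (SSP M) ↔ RightAbundant M := by
  constructor
  · intro h a
    obtain ⟨s, hs, has⟩ := h ⟨∅, a⟩
    exact ⟨s.elt, hs.ssp_elt, has.ssp_elt⟩
  · rintro h ⟨A, a⟩
    obtain ⟨e, he, hae⟩ := h a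
    exact ⟨⟨e • preSet a A, e⟩, he.ssp _, hae.ssp A⟩
end

section
/- Let M be a monoid and let E = {(F, 1) : F ⊆ M}. The relation L̃_E on S(M) is a right congruence (i.e. if (A,a) L̃_E (B,b) then (A,a)(T,t) L̃_E (B,b)(T,t) for all (T,t) ∈ S(M)) if and only if M is left cancellative. -/
open Pointwise

/-- Two elements of `S(M)` are `L̃_E`-related iff the preimages `a⁻¹A` and `b⁻¹B` coincide. -/
theorem lTilde_iff_preSet_eq {M : Type*} [Monoid M] (s t : SSP M) :
    LTilde {w : SSP M | w.elt = 1} s t ↔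
      preSet s.elt s.carrier = preSet t.elt t.carrier := by
  have mul_eq_self_iff (r w : SSP M) (hw : w.elt = 1) :
      r * w = r ↔ w.carrier ⊆ preSet r.elt r.carrier := by
    cases r
    simp [SSP.mul_def, hw, Set.subset_def, Set.mem_smul_set, preSet]
  constructor
  · intro h
    ext x
    have hx := Set.ext_iff.1 h ⟨{x}, 1⟩
    simpa [mul_eq_self_iff] using hx
  · intro h
    ext w
    refine and_congr_right fun hw => ?_
    rw [mul_eq_self_iff s w hw, mul_eq_self_iff t w hw, h]

theorem stmt7 (M : Type*) [Monoid M] :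
    (∀ s t u : SSP M, LTilde {w : SSP M | w.elt = 1} s t →
        LTilde {w : SSP M | w.elt = 1} (s * u) (t * u)) ↔
      ∀ a u v : M, a * u = a * v → u = v := by
  simp only [lTilde_iff_preSet_eq]
  constructor
  · intro h a u v huv
    have hv := Set.ext_iff.1 (h ⟨∅, a⟩ ⟨∅, 1⟩ ⟨{u}, 1⟩ (by simp [preSet])) v
    simpa [preSet, SSP.mul_def, huv, eq_comm] using hv
  · intro h s t u hst
    have mem_preSet_mul (r : SSP M) (x : M) :
        x ∈ preSet (r * u).elt (r * u).carrier ↔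
          u.elt * x ∈ preSet r.elt r.carrier ∨ u.elt * x ∈ u.carrier := by
      simp only [preSet, SSP.mul_def, Set.mem_ofPred_eq, Set.mem_union, mul_assoc]
      refine or_congr_right ⟨?_, Set.smul_mem_smul_set⟩
      rintro ⟨y, hy, hxy⟩
      rwa [← h _ _ _ hxy]
    ext x
    rw [mem_preSet_mul, mem_preSet_mul, hst]
end

section
/- Let M be a monoid. The special semidirect product S(M) satisfies condition (R) if and only if M is finite. -/
open Pointwise

theorem stmt8 (M : Type*) [Monoid M] :
    CondR (SSP M) ↔ Finite M := by
  constructor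
  · intro h
    obtain ⟨X, hX, -, hgen⟩ := h ⟨Set.univ, 1⟩ ⟨Set.univ, 1⟩
    have hcover : (Set.univ : Set (Set M)) ⊆ (fun p => p.2.carrier) '' X := by
      intro V _
      obtain ⟨p, hp, m, hu, hv⟩ := (hgen ⟨∅, 1⟩ ⟨V, 1⟩).1 (by simp [SSP.mul_def])
      simp only [SSP.mul_def, SSP.mk.injEq] at hu hv
      have hm : m.carrier = ∅ := Set.smul_set_eq_empty.1 (Set.union_empty_iff.1 hu.1.symm).2
      refine ⟨p, hp, ?_⟩
      simpa [hm] using hv.1.symm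
    have : Finite (Set M) := Set.finite_univ_iff.1 ((hX.image _).subset hcover)
    exact Finite.of_injective (fun x : M => ({x} : Set M)) Set.singleton_injective
  · intro _ a b
    have : Finite (SSP M) :=
      Finite.of_injective (fun s : SSP M => (s.carrier, s.elt)) (by
        rintro ⟨A, x⟩ ⟨B, y⟩ h
        simpa using h)
    refine ⟨{p | a * p.1 = b * p.2}, Set.toFinite _, fun _ hp => hp, fun u v => ⟨?_, ?_⟩⟩
    · exact fun h => ⟨(u, v), h, 1, by simp⟩
    · rintro ⟨p, hp, m, rfl, rfl⟩
      rw [← mul_assoc, ← mul_assoc, show a * p.1 = b * p.2 from hp]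
end

section
/- Let M be a monoid. The special semidirect product S(M) satisfies condition (L) if and only if M is finite. -/
open Pointwise

instance SSP.instFinite (M : Type*) [Monoid M] [Finite M] : Finite (SSP M) :=
  Finite.of_injective (fun s : SSP M => (s.carrier, s.elt)) fun s t h => by
    cases s
    cases t
    simpa using h

theorem condL_of_finite (N : Type*) [Monoid N] [Finite N] : CondL N := fun a b =>
  ⟨{p | p.1 * a = p.2 * b}, Set.toFinite _, fun _ hp => hp, fun u v =>
    ⟨fun h => ⟨(u, v), h, 1, by simp, by simp⟩, by
      rintro ⟨p, hp, m, rfl, rfl⟩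
      rw [mul_assoc, mul_assoc, show p.1 * a = p.2 * b from hp]⟩⟩

/-- The subsets of an infinite type are not covered by a product of the type with a finite set. -/
theorem not_surjective_prod_finite_set {α β : Type*} [Infinite α] [Finite β] (f : α × β → Set α) :
    ¬ Function.Surjective f := by
  intro hf
  have : Nonempty β := ⟨(hf ∅).choose.2⟩
  obtain ⟨g⟩ : Nonempty (α ≃ α × β) := by
    rw [← Cardinal.lift_mk_eq', Cardinal.mk_prod, Cardinal.lift_mul, Cardinal.lift_lift,
      Cardinal.lift_lift]
    symm
    rw [Cardinal.mul_eq_left]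
    · simp
    · exact le_trans (b := Cardinal.aleph0) (by simp) (by simp)
    · simp
  exact Function.cantor_surjective (f ∘ g) (hf.comp g.surjective)

/-- The pairs `((∅, 1), (V, 1))` all lie in `L(a, a)` for `a = (M, 1)`, and each is determined by
its generator together with the `M`-component of its multiplier. -/
theorem finite_of_condL_ssp (M : Type*) [Monoid M] (h : CondL (SSP M)) : Finite M := by
  by_contra hM
  rw [not_finite_iff_infinite] at hM
  obtain ⟨X, hX, -, hgen⟩ := h ⟨Set.univ, 1⟩ ⟨Set.univ, 1⟩
  have : Finite X := hX
  refine not_surjective_prod_finite_set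
    (fun q : M × X => q.1 • (q.2 : SSP M × SSP M).2.carrier) fun V => ?_
  obtain ⟨p, hp, m, h₁, h₂⟩ := (hgen ⟨∅, 1⟩ ⟨V, 1⟩).1 (by simp [SSP.mul_def])
  simp only [SSP.mul_def, SSP.mk.injEq] at h₁ h₂
  have hm : m.carrier = ∅ := (Set.union_empty_iff.1 h₁.1.symm).1
  exact ⟨(m.elt, ⟨p, hp⟩), by simp [h₂.1, hm]⟩

theorem stmt9 (M : Type*) [Monoid M] :
    CondL (SSP M) ↔ Finite M :=
  ⟨finite_of_condL_ssp M, fun _ => condL_of_finite (SSP M)⟩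
end

section
/- Let M be a monoid. The special semidirect product S(M) is right ideal Howson if and only if M is strongly right ideal Howson. Moreover, S(M) is principally right ideal Howson if and only if M is principally right ideal Howson. -/
open Pointwise

namespace SSP

variable {M : Type*} [Monoid M]

theorem mem_rIdeal_self {N : Type*} [Monoid N] (a : N) : a ∈ rIdeal a := ⟨1, (mul_one a).symm⟩

theorem rIdeal_subset_of_mem {N : Type*} [Monoid N] {a b : N} (h : b ∈ rIdeal a) :
    rIdeal b ⊆ rIdeal a := by
  rintro _ ⟨m, rfl⟩
  obtain ⟨k, rfl⟩ := h
  exact ⟨k * m, mul_assoc _ _ _⟩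

theorem mem_rIdeal_iff {s t : SSP M} :
    t ∈ rIdeal s ↔ t.elt ∈ rIdeal s.elt ∧ s.carrier ⊆ t.carrier ∧
      t.carrier ⊆ s.carrier ∪ rIdeal s.elt := by
  constructor
  · rintro ⟨m, rfl⟩
    refine ⟨⟨m.elt, rfl⟩, Set.subset_union_left, Set.union_subset_union_right _ ?_⟩
    rintro _ ⟨y, -, rfl⟩
    exact ⟨y, rfl⟩
  · rcases s with ⟨A, a⟩
    rcases t with ⟨C, c⟩
    rintro ⟨⟨m, hm⟩, hAC, hCA⟩
    refine ⟨⟨preSet a C, m⟩, ?_⟩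
    rw [mul_def, mk.injEq]
    refine ⟨Set.Subset.antisymm (fun x hx => ?_) (Set.union_subset hAC ?_), hm⟩
    · rcases hCA hx with h | ⟨y, rfl⟩
      · exact Or.inl h
      · exact Or.inr ⟨y, hx, rfl⟩
    · rintro _ ⟨y, hy, rfl⟩
      exact hy

/-- A nonempty intersection of principal right ideals of `S(M)` depends only on the union of the
carriers and on the intersection of the underlying principal right ideals of `M`. -/
theorem mem_inter_rIdeal_iff {s s' : SSP M} (h : (rIdeal s ∩ rIdeal s').Nonempty) {t : SSP M} :
    t ∈ rIdeal s ∩ rIdeal s' ↔ t.elt ∈ rIdeal s.elt ∩ rIdeal s'.elt ∧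
      s.carrier ∪ s'.carrier ⊆ t.carrier ∧
      t.carrier ⊆ (s.carrier ∪ s'.carrier) ∪ (rIdeal s.elt ∩ rIdeal s'.elt) := by
  obtain ⟨r, hr, hr'⟩ := h
  rw [mem_rIdeal_iff] at hr hr'
  rw [Set.mem_inter_iff, mem_rIdeal_iff, mem_rIdeal_iff]
  obtain ⟨-, h1, h2⟩ := hr
  obtain ⟨-, h1', h2'⟩ := hr'
  constructor
  · rintro ⟨⟨h3, h4, h5⟩, h3', h4', h5'⟩
    refine ⟨⟨h3, h3'⟩, Set.union_subset h4 h4', fun x hx => ?_⟩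
    have := h5 hx
    have := h5' hx
    simp only [Set.mem_union, Set.mem_inter_iff] at *
    tauto
  · rintro ⟨⟨h3, h3'⟩, h4, h5⟩
    refine ⟨⟨h3, Set.subset_union_left.trans h4, fun x hx => ?_⟩,
      h3', Set.subset_union_right.trans h4, fun x hx => ?_⟩
    · rcases h5 hx with (h | h) | h
      · exact Or.inl h
      · exact h2 (h1' h)
      · exact Or.inr h.1
    · rcases h5 hx with (h | h) | h
      · exact h2' (h1 h)
      · exact Or.inl h
      · exact Or.inr h.2

theorem mem_inter_rIdeal_empty_iff {a b : M} {t : SSP M} :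
    t ∈ rIdeal (⟨∅, a⟩ : SSP M) ∩ rIdeal ⟨∅, b⟩ ↔
      t.elt ∈ rIdeal a ∩ rIdeal b ∧ t.carrier ⊆ rIdeal a ∩ rIdeal b := by
  simp only [Set.mem_inter_iff, mem_rIdeal_iff, Set.empty_subset, Set.empty_union, true_and,
    Set.subset_inter_iff]
  tauto

/-- Given finitely many sets `U i` and infinite sets `T i`, some set `C` differs from each `U i`
at a point of `T i`. -/
theorem exists_set_differing {ι α : Type*} {s : Set ι} (hs : s.Finite) (T U : ι → Set α)
    (hT : ∀ i ∈ s, (T i).Infinite) :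
    ∃ C : Set α, ∀ i ∈ s, ∃ x ∈ T i, ¬(x ∈ C ↔ x ∈ U i) := by
  suffices ∃ C W : Set α, W.Finite ∧ ∀ i ∈ s, ∃ x ∈ T i ∩ W, ¬(x ∈ C ↔ x ∈ U i) by
    obtain ⟨C, W, -, h⟩ := this
    refine ⟨C, fun i hi => ?_⟩
    obtain ⟨x, hx, hxC⟩ := h i hi
    exact ⟨x, hx.1, hxC⟩
  induction s, hs using Set.Finite.induction_on with
  | empty => exact ⟨∅, ∅, Set.finite_empty, by simp⟩
  | @insert a s _ _ ih =>
    obtain ⟨C, W, hW, h⟩ := ih fun i hi => hT i (Set.mem_insert_of_mem _ hi)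
    obtain ⟨x, hxT, hxW⟩ := ((hT a (Set.mem_insert _ _)).sdiff hW).nonempty
    refine ⟨{y | (y ≠ x ∧ y ∈ C) ∨ (y = x ∧ x ∉ U a)}, insert x W, hW.insert x, ?_⟩
    rintro i (rfl | hi)
    · exact ⟨x, ⟨hxT, Set.mem_insert _ _⟩, by simp⟩
    · obtain ⟨y, ⟨hyT, hyW⟩, hy⟩ := h i hi
      have hne : y ≠ x := fun e => hxW (e ▸ hyW)
      exact ⟨y, ⟨hyT, Set.mem_insert_of_mem _ hyW⟩, by simpa [hne] using hy⟩

theorem rightIdealHowson_of_strongly (hM : StronglyRightIdealHowson M) :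
    RightIdealHowson (SSP M) := by
  intro s s'
  rcases (rIdeal s ∩ rIdeal s').eq_empty_or_nonempty with h | h
  · exact ⟨∅, Set.finite_empty, by simp [h]⟩
  have key := fun t => mem_inter_rIdeal_iff h (t := t)
  set I := rIdeal s.elt ∩ rIdeal s'.elt
  set D := s.carrier ∪ s'.carrier
  obtain ⟨r, hr⟩ := h
  obtain ⟨n, u, -, huI, hIu, hfin⟩ := hM s.elt s'.elt ⟨r.elt, ((key r).1 hr).1⟩
  refine ⟨⋃ i, (fun Y => (⟨D ∪ Y, u i⟩ : SSP M)) '' (I \ rIdeal (u i)).powerset,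
    Set.finite_iUnion fun i => (hfin i).finite_subsets.image _, ?_⟩
  ext t
  rw [key]
  simp only [Set.mem_iUnion, Set.mem_image, exists_prop]
  constructor
  · rintro ⟨ht, hDt, htD⟩
    obtain ⟨i, hi⟩ := Set.mem_iUnion.1 (hIu.subset ht)
    refine ⟨_, ⟨i, t.carrier ∩ (I \ rIdeal (u i)), Set.inter_subset_right, rfl⟩,
      mem_rIdeal_iff.2 ⟨hi, Set.union_subset hDt Set.inter_subset_left, fun x hx => ?_⟩⟩
    by_cases hxu : x ∈ rIdeal (u i)
    · exact Or.inr hxu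
    · exact Or.inl ((htD hx).imp_right fun hxI => ⟨hx, hxI, hxu⟩)
  · rintro ⟨_, ⟨i, Y, hY, rfl⟩, ht⟩
    obtain ⟨h1, h2, h3⟩ := mem_rIdeal_iff.1 ht
    have hsub : rIdeal (u i) ⊆ I :=
      (Set.subset_iUnion (fun i => rIdeal (u i)) i).trans hIu.superset
    refine ⟨hsub h1, Set.subset_union_left.trans h2, h3.trans ?_⟩
    exact Set.union_subset (Set.union_subset_union_right _ (hY.trans Set.sdiff_subset))
      (hsub.trans Set.subset_union_right)

theorem strongly_of_rightIdealHowson (hS : RightIdealHowson (SSP M)) :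
    StronglyRightIdealHowson M := by
  rintro a b ⟨c₀, hc₀⟩
  obtain ⟨F, hF, hFeq⟩ := hS ⟨∅, a⟩ ⟨∅, b⟩
  have key := fun t => mem_inter_rIdeal_empty_iff (a := a) (b := b) (t := t)
  set I := rIdeal a ∩ rIdeal b
  have hFI : ∀ f ∈ F, f.elt ∈ I := fun f hf =>
    ((key f).1 (hFeq ▸ Set.mem_biUnion hf (mem_rIdeal_self f))).1
  set G : Set (SSP M) := {f ∈ F | (I \ rIdeal f.elt).Finite}
  have hG : G.Finite := hF.subset fun f hf => hf.1
  have cover : ∀ c ∈ I, ∃ f ∈ G, c ∈ rIdeal f.elt := by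
    intro c hc
    obtain ⟨C, hC⟩ := exists_set_differing (s := F \ G) (hF.subset Set.sdiff_subset)
      (fun f => I \ rIdeal f.elt) (fun f => f.carrier)
      (fun f hf hfin => hf.2 ⟨hf.1, hfin⟩)
    have hmem : (⟨C ∩ I, c⟩ : SSP M) ∈ ⋃ f ∈ F, rIdeal f :=
      hFeq ▸ (key _).2 ⟨hc, Set.inter_subset_right⟩
    simp only [Set.mem_iUnion, exists_prop] at hmem
    obtain ⟨f, hf, hcf⟩ := hmem
    obtain ⟨h1, h2, h3⟩ := mem_rIdeal_iff.1 hcf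
    refine ⟨f, by_contra fun hfG => ?_, h1⟩
    obtain ⟨x, ⟨hxI, hxf⟩, hx⟩ := hC f ⟨hf, hfG⟩
    exact hx ⟨fun hxC => (h3 ⟨hxC, hxI⟩).resolve_right hxf, fun hxU => (h2 hxU).1⟩
  obtain ⟨n, u, -, hu⟩ := hG.fin_param
  have huG : ∀ i, u i ∈ G := fun i => hu ▸ Set.mem_range_self i
  refine ⟨n, fun i => (u i).elt, ?_, fun i => hFI _ (huG i).1, ?_, fun i => (huG i).2⟩
  · obtain ⟨f, hf, -⟩ := cover c₀ hc₀
    obtain ⟨i, -⟩ : f ∈ Set.range u := hu.symm ▸ hf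
    exact i.pos
  · refine Set.Subset.antisymm (fun c hc => ?_) (Set.iUnion_subset fun i => ?_)
    · obtain ⟨f, hf, hcf⟩ := cover c hc
      obtain ⟨i, rfl⟩ : f ∈ Set.range u := hu.symm ▸ hf
      exact Set.mem_iUnion.2 ⟨i, hcf⟩
    · have := hFI _ (huG i).1
      exact Set.subset_inter (rIdeal_subset_of_mem this.1) (rIdeal_subset_of_mem this.2)

theorem principallyRightIdealHowson_iff :
    PrincipallyRightIdealHowson (SSP M) ↔ PrincipallyRightIdealHowson M := by
  constructor
  · rintro hS a b ⟨c₀, hc₀⟩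
    have key := fun t => mem_inter_rIdeal_empty_iff (a := a) (b := b) (t := t)
    obtain ⟨f, hf⟩ := hS ⟨∅, a⟩ ⟨∅, b⟩ ⟨⟨∅, c₀⟩, (key _).2 ⟨hc₀, Set.empty_subset _⟩⟩
    have hfI := ((key f).1 (hf ▸ mem_rIdeal_self f)).1
    refine ⟨f.elt, Set.Subset.antisymm (fun c hc => ?_)
      (Set.subset_inter (rIdeal_subset_of_mem hfI.1) (rIdeal_subset_of_mem hfI.2))⟩
    have hcf : (⟨∅, c⟩ : SSP M) ∈ rIdeal f := hf ▸ (key _).2 ⟨hc, Set.empty_subset _⟩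
    exact (mem_rIdeal_iff.1 hcf).1
  · intro hM s s' h
    obtain ⟨r, hr⟩ := id h
    obtain ⟨u, hu⟩ := hM s.elt s'.elt ⟨r.elt, ((mem_inter_rIdeal_iff h).1 hr).1⟩
    refine ⟨⟨s.carrier ∪ s'.carrier, u⟩, ?_⟩
    ext t
    rw [mem_inter_rIdeal_iff h, hu, mem_rIdeal_iff]

end SSP

theorem stmt10 (M : Type*) [Monoid M] :
    (RightIdealHowson (SSP M) ↔ StronglyRightIdealHowson M) ∧
    (PrincipallyRightIdealHowson (SSP M) ↔ PrincipallyRightIdealHowson M) :=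
  ⟨⟨SSP.strongly_of_rightIdealHowson, SSP.rightIdealHowson_of_strongly⟩,
    SSP.principallyRightIdealHowson_iff⟩
end

section
/- Let M be a monoid. The special semidirect product S(M) is left ideal Howson if and only if M is left co-ordinated. Moreover, S(M) is principally left ideal Howson if and only if M is left 1-co-ordinated. -/
open Pointwise

theorem mem_lIdeal_inter_iff {M : Type*} [Monoid M] (s t z : SSP M) :
    z ∈ lIdeal s ∩ lIdeal t ↔ ∃ x y : M, z.elt = x * s.elt ∧ z.elt = y * t.elt ∧
      x • s.carrier ∪ y • t.carrier ⊆ z.carrier := by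
  constructor
  · rintro ⟨⟨u, hu⟩, ⟨v, hv⟩⟩
    refine ⟨u.elt, v.elt, congrArg SSP.elt hu, congrArg SSP.elt hv, Set.union_subset ?_ ?_⟩
    · rw [congrArg SSP.carrier hu]
      exact Set.subset_union_right
    · rw [congrArg SSP.carrier hv]
      exact Set.subset_union_right
  · obtain ⟨Z, z⟩ := z
    rintro ⟨x, y, hx, hy, h⟩
    obtain ⟨h₁, h₂⟩ := Set.union_subset_iff.1 h
    refine ⟨⟨⟨Z, x⟩, ?_⟩, ⟨⟨Z, y⟩, ?_⟩⟩
    · rw [SSP.mul_def, SSP.mk.injEq]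
      exact ⟨(Set.union_eq_left.2 h₁).symm, hx⟩
    · rw [SSP.mul_def, SSP.mk.injEq]
      exact ⟨(Set.union_eq_left.2 h₂).symm, hy⟩

/-- A finite generating set of `S(M)(A, a) ∩ S(M)(B, b)` yields a left co-ordinate system. -/
theorem exists_leftCoordSystem {M : Type*} [Monoid M] {a b : M} {A B : Set M}
    {F : Set (SSP M)} (hF : F.Finite)
    (h : lIdeal (⟨A, a⟩ : SSP M) ∩ lIdeal ⟨B, b⟩ = ⋃ f ∈ F, lIdeal f) :
    ∃ C : Set (M × M), LeftCoordSystem a b A B C ∧ (F.Subsingleton → C.Subsingleton) := by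
  have hmem : ∀ f : SSP M, ∃ pq : M × M, f ∈ F → f.elt = pq.1 * a ∧ f.elt = pq.2 * b ∧
      pq.1 • A ∪ pq.2 • B ⊆ f.carrier := by
    intro f
    by_cases hf : f ∈ F
    · have hf' : f ∈ lIdeal (⟨A, a⟩ : SSP M) ∩ lIdeal ⟨B, b⟩ := by
        rw [h]
        exact Set.mem_biUnion hf ⟨1, (one_mul f).symm⟩
      obtain ⟨p, q, hpq⟩ := (mem_lIdeal_inter_iff _ _ _).1 hf'
      exact ⟨(p, q), fun _ => hpq⟩
    · exact ⟨1, fun hf' => absurd hf' hf⟩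
  choose g hg using hmem
  refine ⟨g '' F, ⟨hF.image g, ?_, ?_⟩, fun hs => hs.image g⟩
  · rintro _ ⟨f, hf, rfl⟩
    exact (hg f hf).1.symm.trans (hg f hf).2.1
  · intro x y hxy
    have hz : (⟨x • A ∪ y • B, x * a⟩ : SSP M) ∈ lIdeal (⟨A, a⟩ : SSP M) ∩ lIdeal ⟨B, b⟩ :=
      (mem_lIdeal_inter_iff _ _ _).2 ⟨x, y, rfl, hxy, subset_rfl⟩
    rw [h] at hz
    obtain ⟨f, hf, m, hm⟩ := Set.mem_iUnion₂.1 hz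
    obtain ⟨hp, -, hsub⟩ := hg f hf
    refine ⟨m.elt, g f, ⟨f, hf, rfl⟩, ?_, ?_⟩
    · rw [mul_assoc, ← hp]
      exact congrArg SSP.elt hm
    · rw [mul_smul, mul_smul, ← Set.smul_set_union]
      refine (Set.smul_set_mono hsub).trans ?_
      have hc : x • A ∪ y • B = m.carrier ∪ m.elt • f.carrier := congrArg SSP.carrier hm
      rw [hc]
      exact Set.subset_union_right

/-- A left co-ordinate system yields a generating set of `S(M)(A, a) ∩ S(M)(B, b)`. -/
theorem LeftCoordSystem.lIdeal_inter_eq {M : Type*} [Monoid M] {a b : M} {A B : Set M}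
    {C : Set (M × M)} (hC : LeftCoordSystem a b A B C) :
    lIdeal (⟨A, a⟩ : SSP M) ∩ lIdeal ⟨B, b⟩ =
      ⋃ f ∈ (fun pq : M × M => (⟨pq.1 • A ∪ pq.2 • B, pq.1 * a⟩ : SSP M)) '' C, lIdeal f := by
  obtain ⟨-, hL, hcov⟩ := hC
  ext ⟨Z, z⟩
  rw [Set.biUnion_image, Set.mem_iUnion₂, mem_lIdeal_inter_iff]
  constructor
  · rintro ⟨x, y, hx, hy, hsub⟩
    obtain ⟨t, pq, hpq, ht, hts⟩ := hcov x y (hx.symm.trans hy)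
    refine ⟨pq, hpq, ⟨Z, t⟩, ?_⟩
    rw [SSP.mul_def, SSP.mk.injEq]
    refine ⟨(Set.union_eq_left.2 ?_).symm, ?_⟩
    · simp only [Set.smul_set_union, ← mul_smul]
      exact hts.trans hsub
    · simp only [← mul_assoc]
      exact hx.trans ht
  · rintro ⟨pq, hpq, m, hm⟩
    rw [SSP.mul_def, SSP.mk.injEq] at hm
    obtain ⟨rfl, rfl⟩ := hm
    refine ⟨m.elt * pq.1, m.elt * pq.2, (mul_assoc _ _ _).symm, ?_, ?_⟩
    · rw [mul_assoc, ← show pq.1 * a = pq.2 * b from hL hpq]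
    · simp only [Set.smul_set_union, ← mul_smul]
      exact Set.subset_union_right

theorem stmt11 (M : Type*) [Monoid M] :
    (LeftIdealHowson (SSP M) ↔ LeftCoordinated M) ∧
    (PrincipallyLeftIdealHowson (SSP M) ↔ Left1Coordinated M) := by
  refine ⟨⟨fun h a b A B => ?_, fun h s t => ?_⟩, ⟨fun h a b A B => ?_, fun h s t hne => ?_⟩⟩
  · obtain ⟨F, hF, hFe⟩ := h ⟨A, a⟩ ⟨B, b⟩
    obtain ⟨C, hC, -⟩ := exists_leftCoordSystem hF hFe
    exact ⟨C, hC⟩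
  · obtain ⟨C, hC⟩ := h s.elt t.elt s.carrier t.carrier
    exact ⟨_, hC.1.image _, hC.lIdeal_inter_eq⟩
  · rcases (lIdeal (⟨A, a⟩ : SSP M) ∩ lIdeal ⟨B, b⟩).eq_empty_or_nonempty with he | hne
    · obtain ⟨C, hC, hs⟩ := exists_leftCoordSystem (F := ∅) Set.finite_empty
        (he.trans (Set.biUnion_empty _).symm)
      exact ⟨C, hC, hs Set.subsingleton_empty⟩
    · obtain ⟨u, hu⟩ := h _ _ hne
      obtain ⟨C, hC, hs⟩ := exists_leftCoordSystem (F := {u}) (Set.finite_singleton u)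
        (hu.trans (Set.biUnion_singleton u _).symm)
      exact ⟨C, hC, hs Set.subsingleton_singleton⟩
  · obtain ⟨C, hC, hs⟩ := h s.elt t.elt s.carrier t.carrier
    have heq := hC.lIdeal_inter_eq
    rcases hs.eq_empty_or_singleton with rfl | ⟨pq, rfl⟩
    · rw [Set.image_empty, Set.biUnion_empty] at heq
      exact absurd heq hne.ne_empty
    · rw [Set.image_singleton, Set.biUnion_singleton] at heq
      exact ⟨_, heq⟩
end

section
/- Let M be a monoid with the property that for all a, b, f ∈ M the pair of equations xa = f, yb = f has at most one solution (x, y) ∈ M × M. Then the following are equivalent: M is left ideal Howson; M is left co-ordinated; M satisfies condition (L). -/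
open Pointwise

theorem CondL.leftCoordinated {M : Type*} [Monoid M] (hL : CondL M) : LeftCoordinated M := by
  intro a b A B
  obtain ⟨X, hX, hXL, hgen⟩ := hL a b
  refine ⟨X, hX, hXL, fun x y hxy => ?_⟩
  obtain ⟨p, hp, m, rfl, rfl⟩ := (hgen x y).1 hxy
  exact ⟨m, p, hp, rfl, subset_rfl⟩

theorem LeftCoordinated.leftIdealHowson {M : Type*} [Monoid M] (hC : LeftCoordinated M) :
    LeftIdealHowson M := by
  intro a b
  obtain ⟨C, hC, hCL, hgen⟩ := hC a b ∅ ∅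
  refine ⟨(fun p : M × M => p.1 * a) '' C, hC.image _, ?_⟩
  ext z
  simp only [Set.mem_inter_iff, Set.mem_iUnion, lIdeal, Set.mem_ofPred_eq]
  constructor
  · rintro ⟨⟨x, rfl⟩, y, hy⟩
    obtain ⟨t, p, hp, ht, -⟩ := hgen x y hy
    exact ⟨_, ⟨p, hp, rfl⟩, t, by rw [ht, mul_assoc]⟩
  · rintro ⟨_, ⟨p, hp, rfl⟩, t, rfl⟩
    have hpL : p.1 * a = p.2 * b := hCL hp
    exact ⟨⟨t * p.1, by rw [mul_assoc]⟩, t * p.2, by rw [mul_assoc, ← hpL]⟩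

theorem LeftIdealHowson.condL {M : Type*} [Monoid M]
    (h : ∀ a b f x y x' y' : M,
      x * a = f → y * b = f → x' * a = f → y' * b = f → x = x' ∧ y = y')
    (hH : LeftIdealHowson M) : CondL M := by
  intro a b
  obtain ⟨F, hF, hab⟩ := hH a b
  refine ⟨{p | p.1 * a ∈ F ∧ p.1 * a = p.2 * b}, ?_, fun p hp => hp.2, fun u v => ?_⟩
  · refine Set.Finite.of_finite_image (f := fun p : M × M => p.1 * a)
      (hF.subset ?_) ?_
    · rintro _ ⟨p, hp, rfl⟩
      exact hp.1
    · intro p hp q hq hpq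
      have hqp : q.1 * a = p.1 * a := hpq.symm
      obtain ⟨h₁, h₂⟩ := h a b (p.1 * a) p.1 p.2 q.1 q.2 rfl hp.2.symm hqp
        (hq.2.symm.trans hqp)
      exact Prod.ext h₁ h₂
  · constructor
    · intro huv
      have hmem : u * a ∈ lIdeal a ∩ lIdeal b := ⟨⟨u, rfl⟩, v, huv⟩
      rw [hab] at hmem
      simp only [Set.mem_iUnion] at hmem
      obtain ⟨f, hf, m, hm⟩ := hmem
      have hfab : f ∈ lIdeal a ∩ lIdeal b := by
        rw [hab]
        exact Set.mem_biUnion hf ⟨1, (one_mul f).symm⟩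
      obtain ⟨⟨p, hp⟩, q, hq⟩ := hfab
      obtain ⟨h₁, h₂⟩ := h a b (u * a) u v (m * p) (m * q) rfl huv.symm
        (by rw [mul_assoc, ← hp, hm]) (by rw [mul_assoc, ← hq, hm])
      exact ⟨(p, q), ⟨hp ▸ hf, hp.symm.trans hq⟩, m, h₁, h₂⟩
    · rintro ⟨p, hp, m, rfl, rfl⟩
      rw [mul_assoc, mul_assoc, hp.2]

theorem stmt12 (M : Type*) [Monoid M]
    (h : ∀ a b f x y x' y' : M,
      x * a = f → y * b = f → x' * a = f → y' * b = f → x = x' ∧ y = y') :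
    (LeftIdealHowson M ↔ LeftCoordinated M) ∧ (LeftCoordinated M ↔ CondL M) := by
  exact ⟨⟨fun hH => (hH.condL h).leftCoordinated, fun hC => hC.leftIdealHowson⟩,
    ⟨fun hC => hC.leftIdealHowson.condL h, fun hL => hL.leftCoordinated⟩⟩
end

section
/- Let M be a right cancellative monoid. Then the special semidirect product S(M) is left ideal Howson if and only if M is left ideal Howson. -/
open Pointwise

theorem SSP.mem_lIdeal_iff {M : Type*} [Monoid M] {s t : SSP M} :
    s ∈ lIdeal t ↔ ∃ x : M, s.elt = x * t.elt ∧ x • t.carrier ⊆ s.carrier := by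
  obtain ⟨S, z⟩ := s
  constructor
  · rintro ⟨m, hm⟩
    rw [SSP.mul_def, SSP.mk.injEq] at hm
    exact ⟨m.elt, hm.2, hm.1 ▸ Set.subset_union_right⟩
  · rintro ⟨x, hx, hS⟩
    exact ⟨⟨S, x⟩, by rw [SSP.mul_def, SSP.mk.injEq]; exact ⟨(Set.union_eq_left.2 hS).symm, hx⟩⟩

theorem mem_lIdeal_self {N : Type*} [Monoid N] (a : N) : a ∈ lIdeal a :=
  ⟨1, (one_mul a).symm⟩

theorem lIdeal_subset_of_mem {N : Type*} [Monoid N] {a b : N} (h : a ∈ lIdeal b) :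
    lIdeal a ⊆ lIdeal b := by
  obtain ⟨m, rfl⟩ := h
  rintro _ ⟨k, rfl⟩
  exact ⟨k * m, (mul_assoc k m b).symm⟩

theorem lIdeal_inter_eq_biUnion_iff {N : Type*} [Monoid N] {a b : N} {F : Set N} :
    lIdeal a ∩ lIdeal b = ⋃ f ∈ F, lIdeal f ↔
      (∀ f ∈ F, f ∈ lIdeal a ∧ f ∈ lIdeal b) ∧
        ∀ z, z ∈ lIdeal a → z ∈ lIdeal b → ∃ f ∈ F, z ∈ lIdeal f := by
  constructor
  · intro h
    refine ⟨fun f hf => ?_, fun z ha hb => ?_⟩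
    · have : f ∈ ⋃ f ∈ F, lIdeal f := Set.mem_biUnion hf (mem_lIdeal_self f)
      rwa [← h] at this
    · have : z ∈ lIdeal a ∩ lIdeal b := ⟨ha, hb⟩
      simpa only [h, Set.mem_iUnion, exists_prop] using this
  · rintro ⟨hF, h⟩
    refine Set.Subset.antisymm (fun z hz => ?_) (Set.iUnion₂_subset fun f hf => ?_)
    · simpa only [Set.mem_iUnion, exists_prop] using h z hz.1 hz.2
    · exact Set.subset_inter (lIdeal_subset_of_mem (hF f hf).1) (lIdeal_subset_of_mem (hF f hf).2)

/-- No cancellativity is needed to pass from `S(M)` to `M`. -/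
theorem LeftIdealHowson.of_ssp {M : Type*} [Monoid M] (h : LeftIdealHowson (SSP M)) :
    LeftIdealHowson M := by
  intro a b
  obtain ⟨F, hfin, hF⟩ := h ⟨∅, a⟩ ⟨∅, b⟩
  rw [lIdeal_inter_eq_biUnion_iff] at hF
  refine ⟨SSP.elt '' F, hfin.image _, lIdeal_inter_eq_biUnion_iff.2 ⟨?_, ?_⟩⟩
  · rintro _ ⟨f, hf, rfl⟩
    obtain ⟨⟨x, hx, -⟩, ⟨y, hy, -⟩⟩ :=
      (hF.1 f hf).imp SSP.mem_lIdeal_iff.1 SSP.mem_lIdeal_iff.1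
    exact ⟨⟨x, hx⟩, ⟨y, hy⟩⟩
  · rintro z ⟨x, hx⟩ ⟨y, hy⟩
    obtain ⟨f, hf, hz⟩ := hF.2 ⟨∅, z⟩ (SSP.mem_lIdeal_iff.2 ⟨x, hx, by simp⟩)
      (SSP.mem_lIdeal_iff.2 ⟨y, hy, by simp⟩)
    obtain ⟨t, ht, -⟩ := SSP.mem_lIdeal_iff.1 hz
    exact ⟨f.elt, ⟨f, hf, rfl⟩, t, ht⟩

theorem LeftIdealHowson.ssp {M : Type*} [Monoid M]
    (hc : ∀ u v a : M, u * a = v * a → u = v) (h : LeftIdealHowson M) :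
    LeftIdealHowson (SSP M) := by
  rintro ⟨A, a⟩ ⟨B, b⟩
  obtain ⟨F, hfin, hF⟩ := h a b
  obtain ⟨hF, hgen⟩ := lIdeal_inter_eq_biUnion_iff.1 hF
  choose! p hp using fun f hf => (hF f hf).1
  choose! q hq using fun f hf => (hF f hf).2
  refine ⟨(fun f => ⟨p f • A ∪ q f • B, f⟩) '' F, hfin.image _,
    lIdeal_inter_eq_biUnion_iff.2 ⟨?_, ?_⟩⟩
  · rintro _ ⟨f, hf, rfl⟩
    exact ⟨SSP.mem_lIdeal_iff.2 ⟨p f, hp f hf, Set.subset_union_left⟩,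
      SSP.mem_lIdeal_iff.2 ⟨q f, hq f hf, Set.subset_union_right⟩⟩
  · rintro ⟨Z, z⟩ hza hzb
    obtain ⟨x, hx, hxA⟩ := SSP.mem_lIdeal_iff.1 hza
    obtain ⟨y, hy, hyB⟩ := SSP.mem_lIdeal_iff.1 hzb
    obtain ⟨f, hf, t, ht⟩ := hgen z ⟨x, hx⟩ ⟨y, hy⟩
    refine ⟨_, ⟨f, hf, rfl⟩, SSP.mem_lIdeal_iff.2 ⟨t, ht, ?_⟩⟩
    have hxt : t * p f = x := hc _ _ a (by rw [mul_assoc, ← hp f hf, ← ht]; exact hx)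
    have hyt : t * q f = y := hc _ _ b (by rw [mul_assoc, ← hq f hf, ← ht]; exact hy)
    rw [Set.smul_set_union, smul_smul, smul_smul, hxt, hyt]
    exact Set.union_subset hxA hyB

theorem stmt13 (M : Type*) [Monoid M] (hc : ∀ u v a : M, u * a = v * a → u = v) :
    LeftIdealHowson (SSP M) ↔ LeftIdealHowson M :=
  ⟨LeftIdealHowson.of_ssp, LeftIdealHowson.ssp hc⟩
end

section
/- Let M be a monoid and let φ : M → M be a monoid homomorphism with φ ∘ φ = φ (a retraction), and let T be the image of φ, regarded as a monoid. If M is left co-ordinated then T is left co-ordinated, and if M is left 1-co-ordinated then T is left 1-co-ordinated. -/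
open Pointwise

/-- A left co-ordinate system is carried along a homomorphism that has a section. -/
theorem LeftCoordSystem.map {M T : Type*} [Monoid M] [Monoid T] (f : M →* T) (g : T →* M)
    (hfg : ∀ t, f (g t) = t) {a b : T} {A B : Set T} {C : Set (M × M)}
    (h : LeftCoordSystem (g a) (g b) (g '' A) (g '' B) C) :
    LeftCoordSystem a b A B (Prod.map f f '' C) := by
  obtain ⟨hfin, hsub, hcov⟩ := h
  have himage : ∀ (m : M) (D : Set T), f '' (m • (g '' D)) = f m • D := by
    intro m D
    rw [← Set.image_smul, ← Set.image_smul, Set.image_image, Set.image_image]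
    simp [hfg]
  refine ⟨hfin.image _, ?_, ?_⟩
  · rintro _ ⟨pq, hpq, rfl⟩
    simpa [hfg] using congrArg f (hsub hpq)
  · intro x y hxy
    obtain ⟨t, pq, hpq, heq, hss⟩ := hcov (g x) (g y) (by rw [← map_mul, hxy, map_mul])
    refine ⟨f t, _, ⟨pq, hpq, rfl⟩, by simpa [hfg] using congrArg f heq, ?_⟩
    simpa only [Set.image_union, himage, map_mul, hfg, Prod.map_fst, Prod.map_snd] using
      Set.image_mono (f := f) hss

theorem stmt14 (M : Type*) [Monoid M] (φ : M →* M) (hret : ∀ x : M, φ (φ x) = φ x) :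
    (LeftCoordinated M → LeftCoordinated ↥(MonoidHom.mrange φ)) ∧
    (Left1Coordinated M → Left1Coordinated ↥(MonoidHom.mrange φ)) := by
  have hfg : ∀ t : ↥(MonoidHom.mrange φ),
      φ.mrangeRestrict ((MonoidHom.mrange φ).subtype t) = t := by
    rintro ⟨_, x, rfl⟩
    exact Subtype.ext (hret x)
  constructor
  · intro h a b A B
    obtain ⟨C, hC⟩ := h _ _ _ _
    exact ⟨_, hC.map _ _ hfg⟩
  · intro h a b A B
    obtain ⟨C, hC, hsub⟩ := h _ _ _ _
    exact ⟨_, hC.map _ _ hfg, hsub.image _⟩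
end

section
/- Let M be an infinite monoid and suppose there exists x ∈ M such that: (i) whenever p ∈ M has a right inverse (pp' = 1 for some p') and xp = xq for some q ∈ M, then p = q; and (ii) for every finite subset A of M there exist u, v ∈ M \ A with xu = xv and u ≠ v. Then the right annihilator congruence r((∅, x)) on S(M) is not finitely generated as a right congruence; in particular, S(M) is not finitely right equated. -/
open Pointwise

/-- The syntactic right congruence of an element `s`. -/
theorem isRightCong_syntactic {N : Type*} [Monoid N] (s : N) :
    IsRightCong fun a b : N => ∀ c, a * c = s ↔ b * c = s := by
  refine ⟨⟨fun _ _ => Iff.rfl, fun h c => (h c).symm, fun h k c => (h c).trans (k c)⟩, ?_⟩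
  intro a b c h d
  simpa only [mul_assoc] using h (c * d)

/-- Replacing a left factor `a` of `({u}, 1)` by an `r((∅, x))`-related element `b` does not change
the product, unless the set component of `a` is `{u}`. -/
theorem SSP.mul_eq_of_rAnn {M : Type*} [Monoid M] {x u : M}
    (h : ∀ p q : M, (∃ p' : M, p * p' = 1) → x * p = x * q → p = q)
    {a b c : SSP M} (hab : rAnn (SSP.mk ∅ x) a b) (ha : a.carrier ≠ {u})
    (hac : a * c = ⟨{u}, 1⟩) : b * c = ⟨{u}, 1⟩ := by
  obtain ⟨P, p⟩ := a
  obtain ⟨Q, q⟩ := b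
  obtain ⟨T, t⟩ := c
  simp only [rAnn, SSP.mul_def, SSP.mk.injEq, Set.empty_union] at hab hac ha ⊢
  obtain ⟨hPQ, hpq⟩ := hab
  obtain ⟨hPT, hpt⟩ := hac
  obtain rfl := h p q ⟨t, hpt⟩ hpq
  have hP : P = ∅ :=
    (Set.subset_singleton_iff_eq.1 (hPT ▸ Set.subset_union_left)).resolve_right ha
  subst hP
  have hQ : Q = ∅ := by simpa using hPQ.symm
  subst hQ
  exact ⟨hPT, hpt⟩

theorem stmt15 (M : Type*) [Monoid M] [Infinite M] (x : M)
    (h1 : ∀ p q : M, (∃ p' : M, p * p' = 1) → x * p = x * q → p = q)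
    (h2 : ∀ A : Set M, A.Finite → ∃ u v : M, u ∉ A ∧ v ∉ A ∧ x * u = x * v ∧ u ≠ v) :
    (¬ ∃ W : Set (SSP M × SSP M), W.Finite ∧ rAnn (SSP.mk ∅ x) = rightCongGen W) ∧
    ¬ FinitelyRightEquated (SSP M) := by
  have key : ¬ ∃ W : Set (SSP M × SSP M),
      W.Finite ∧ rAnn (SSP.mk ∅ x) = rightCongGen W := by
    rintro ⟨W, hW, hgen⟩
    have hfin : {u : M | ∃ w ∈ W, w.1.carrier = {u} ∨ w.2.carrier = {u}}.Finite := by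
      have hsets : ((fun w => w.1.carrier) '' W ∪ (fun w => w.2.carrier) '' W).Finite :=
        (hW.image _).union (hW.image _)
      refine (hsets.preimage (f := fun u : M => ({u} : Set M))
        Set.singleton_injective.injOn).subset ?_
      rintro u ⟨w, hw, hu | hu⟩
      · exact Or.inl ⟨w, hw, hu⟩
      · exact Or.inr ⟨w, hw, hu⟩
    obtain ⟨u, v, hu, -, huv, hne⟩ := h2 _ hfin
    have hrel : rightCongGen W (⟨{u}, 1⟩ : SSP M) ⟨{v}, 1⟩ := by
      rw [← hgen]
      simp [rAnn, SSP.mul_def, huv]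
    have hsyn := hrel _ (isRightCong_syntactic ⟨{u}, 1⟩) fun w hw c => by
      have hann : rAnn (SSP.mk ∅ x) w.1 w.2 := by
        rw [hgen]
        exact fun r _ hr => hr w hw
      exact ⟨SSP.mul_eq_of_rAnn h1 hann fun he => hu ⟨w, hw, Or.inl he⟩,
        SSP.mul_eq_of_rAnn h1 hann.symm fun he => hu ⟨w, hw, Or.inr he⟩⟩
    have hvu := (hsyn 1).1 (mul_one _)
    rw [mul_one, SSP.mk.injEq, Set.singleton_eq_singleton_iff] at hvu
    exact hne hvu.1.symm
  exact ⟨key, fun h => key (h _)⟩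
end

section
/- Let M be a monoid and let a, e ∈ M with e idempotent and a L*-related to e. Then for any subset A ⊆ M, the right annihilator congruence r((A, a)) on S(M) is equal to the right congruence generated by the single pair ((∅, 1), (a⁻¹A, e)); in particular, r((A, a)) is finitely generated as a right congruence. -/
open Pointwise

theorem LStarRel.mul_idempotent {M : Type*} [Monoid M] {a e : M} (hae : LStarRel a e)
    (he : IsIdempotentElem e) : a * e = a := by
  simpa using (hae e 1).2 (by simpa using he.eq)

theorem rAnn_isRightCong {N : Type*} [Monoid N] (s : N) : IsRightCong (rAnn s) := by
  refine ⟨⟨fun _ => rfl, fun h => h.symm, fun h h' => h.trans h'⟩, fun u v c h => ?_⟩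
  change s * (u * c) = s * (v * c)
  rw [← mul_assoc, ← mul_assoc, show s * u = s * v from h]

/-- If `A ∪ aX ⊆ A ∪ aY` then `eX ⊆ a⁻¹A ∪ eY`, for an idempotent `e` that is `L*`-related
to `a`. -/
theorem smul_subset_preSet_union {M : Type*} [Monoid M] {a e : M} (he : IsIdempotentElem e)
    (hae : LStarRel a e) {A X Y : Set M} (h : A ∪ a • X ⊆ A ∪ a • Y) :
    e • X ⊆ preSet a A ∪ e • Y := by
  rintro _ ⟨u, hu, rfl⟩
  rcases h (Or.inr ⟨u, hu, rfl⟩) with hA | ⟨v, hv, huv⟩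
  · left
    change a * (e * u) ∈ A
    rwa [← mul_assoc, hae.mul_idempotent he]
  · exact Or.inr ⟨v, hv, (hae v u).1 huv⟩

theorem rAnn_one_preSet {M : Type*} [Monoid M] {a e : M} (he : IsIdempotentElem e)
    (hae : LStarRel a e) (A : Set M) :
    rAnn (SSP.mk A a) (SSP.mk ∅ 1) (SSP.mk (preSet a A) e) := by
  have hsub : a • preSet a A ⊆ A := by
    rintro _ ⟨u, hu, rfl⟩
    exact hu
  simp [rAnn, SSP.mul_def, hae.mul_idempotent he, Set.union_eq_self_of_subset_right hsub]

theorem preSet_mul_eq_of_rAnn {M : Type*} [Monoid M] {a e : M} (he : IsIdempotentElem e)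
    (hae : LStarRel a e) {A : Set M} {s t : SSP M} (h : rAnn (SSP.mk A a) s t) :
    SSP.mk (preSet a A) e * s = SSP.mk (preSet a A) e * t := by
  simp only [rAnn, SSP.mul_def, SSP.mk.injEq] at h ⊢
  refine ⟨Set.Subset.antisymm ?_ ?_, (hae _ _).1 h.2⟩
  · exact Set.union_subset Set.subset_union_left (smul_subset_preSet_union he hae h.1.subset)
  · exact Set.union_subset Set.subset_union_left (smul_subset_preSet_union he hae h.1.superset)

theorem stmt16 (M : Type*) [Monoid M] (a e : M) (he : IsIdempotentElem e)
    (hae : LStarRel a e) (A : Set M) :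
    rAnn (SSP.mk A a) = rightCongGen {(SSP.mk ∅ 1, SSP.mk (preSet a A) e)} ∧
    ∃ W : Set (SSP M × SSP M), W.Finite ∧ rAnn (SSP.mk A a) = rightCongGen W := by
  have key : rAnn (SSP.mk A a) = rightCongGen {(SSP.mk ∅ 1, SSP.mk (preSet a A) e)} := by
    funext s t
    refine propext ⟨fun h r hr hW => ?_, fun h => h _ (rAnn_isRightCong _) ?_⟩
    · have hmul (u : SSP M) : r u (SSP.mk (preSet a A) e * u) := by
        have := hr.2 _ _ u (hW _ rfl)
        rwa [← SSP.one_def, one_mul] at this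
      have ht := hmul t
      rw [← preSet_mul_eq_of_rAnn he hae h] at ht
      exact hr.1.trans (hmul s) (hr.1.symm ht)
    · rintro _ rfl
      exact rAnn_one_preSet he hae A
  exact ⟨key, _, Set.finite_singleton _, key⟩
end

section
/- Let M be a monoid and let a ∈ M be such that there are infinitely many distinct pairs (b, c) ∈ M × M with ba = ca, with b indecomposable, and with c ∉ bM. Then the left annihilator congruence l(({1}, a)) on S(M) is not finitely generated as a left congruence. -/
open Pointwise

/-- If no generating pair relates an element over `b` to one over `c`, membership in
`{(X, b) : X ⊆ {b, c}}` is transported along left multiples of that pair. -/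
theorem mul_mem_of_lAnn {M : Type*} [Monoid M] {a b c : M} (hb : Indecomposable b)
    (hc : c ∉ rIdeal b) {u v : SSP M} (huv : lAnn (SSP.mk {1} a) u v)
    (hne : (u.elt, v.elt) ≠ (b, c)) (t : SSP M)
    (ht : (t * u).elt = b ∧ (t * u).carrier ⊆ {b, c}) :
    (t * v).elt = b ∧ (t * v).carrier ⊆ {b, c} := by
  obtain ⟨X, x⟩ := u
  obtain ⟨Y, y⟩ := v
  obtain ⟨Z, z⟩ := t
  simp only [lAnn, SSP.mul_def, SSP.mk.injEq, Set.smul_set_singleton, smul_eq_mul, mul_one]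
    at huv ht hne ⊢
  obtain ⟨hXY, -⟩ := huv
  obtain ⟨hzx, hsub⟩ := ht
  have hX : ∀ w ∈ X, z * w = b ∨ z * w = c := fun w hw =>
    hsub (Or.inr (Set.smul_mem_smul_set hw))
  have hY : ∀ w ∈ Y ∪ {y}, z * w = b ∨ z * w = c := by
    rw [← hXY]
    rintro w (hw | rfl)
    · exact hX w hw
    · exact Or.inl hzx
  refine ⟨?_, ?_⟩
  · refine (hY y (Or.inr rfl)).resolve_right fun hzy => ?_
    rcases (hb z x hzx.symm).1 with rfl | rfl
    · rw [one_mul] at hzx hzy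
      exact hne (by rw [hzx, hzy])
    · exact hc ⟨y, hzy.symm⟩
  · rintro w (hw | ⟨w, hw, rfl⟩)
    · exact hsub (Or.inl hw)
    · exact hY w (Or.inl hw)

/-- The largest left congruence saturating a set `K`. -/
theorem isLeftCong_saturating {N : Type*} [Monoid N] (K : Set N) :
    IsLeftCong fun u v : N => ∀ t : N, t * u ∈ K ↔ t * v ∈ K :=
  ⟨⟨fun _ _ => Iff.rfl, fun h t => (h t).symm, fun h k t => (h t).trans (k t)⟩,
    fun _ _ d h t => by simpa only [mul_assoc] using h (t * d)⟩

/-- Every generating set of `l(({1}, a))` contains a pair lying over `(b, c)`, up to order. -/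
theorem exists_mem_of_lAnn_eq {M : Type*} [Monoid M] {a b c : M} (habc : b * a = c * a)
    (hb : Indecomposable b) (hc : c ∉ rIdeal b) {W : Set (SSP M × SSP M)}
    (hW : lAnn (SSP.mk {1} a) = leftCongGen W) :
    ∃ p ∈ W, (p.1.elt, p.2.elt) = (b, c) ∨ (p.2.elt, p.1.elt) = (b, c) := by
  by_contra! hcon
  have htarget : lAnn (SSP.mk {1} a) (SSP.mk {c} b) (SSP.mk {b} c) := by
    simp [lAnn, SSP.mul_def, habc, Set.pair_comm]
  rw [hW] at htarget
  have key := htarget _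
    (isLeftCong_saturating {u : SSP M | u.elt = b ∧ u.carrier ⊆ {b, c}}) fun p hp t => by
      have hann : lAnn (SSP.mk {1} a) p.1 p.2 := by
        rw [hW]
        exact fun _ _ h => h p hp
      exact ⟨mul_mem_of_lAnn hb hc hann (hcon p hp).1 t,
        mul_mem_of_lAnn hb hc hann.symm (hcon p hp).2 t⟩
  have hcb : c = b := by
    have := (key 1).1 (by simp)
    simpa using this.1
  exact hc ⟨1, by rw [hcb, mul_one]⟩

theorem stmt17 (M : Type*) [Monoid M] (a : M)
    (h : {bc : M × M | bc.1 * a = bc.2 * a ∧ Indecomposable bc.1 ∧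
            bc.2 ∉ rIdeal bc.1}.Infinite) :
    ¬ ∃ W : Set (SSP M × SSP M), W.Finite ∧ lAnn (SSP.mk {1} a) = leftCongGen W := by
  rintro ⟨W, hfin, hW⟩
  refine h (((hfin.image fun p => (p.1.elt, p.2.elt)).union
    (hfin.image fun p => (p.2.elt, p.1.elt))).subset ?_)
  rintro ⟨b, c⟩ ⟨habc, hb, hc⟩
  obtain ⟨p, hp, h | h⟩ := exists_mem_of_lAnn_eq habc hb hc hW
  · exact Or.inl ⟨p, hp, h⟩
  · exact Or.inr ⟨p, hp, h⟩
end

section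
/- Let M be a right cancellative monoid. Then for every element (A, a) of S(M), the left annihilator congruence l((A, a)) on S(M) is equal to the left congruence generated by the single pair ((A, 1), (∅, 1)); in particular, S(M) is finitely left equated. -/
open Pointwise

/-- The left annihilator of an element is a left congruence. -/
theorem isLeftCong_lAnn {N : Type*} [Monoid N] (s : N) : IsLeftCong (lAnn s) := by
  refine ⟨⟨fun _ => rfl, fun h => Eq.symm h, fun h k => Eq.trans h k⟩, fun u v c h => ?_⟩
  simp only [lAnn] at h ⊢
  rw [mul_assoc, h, mul_assoc]

/-- In `S(M)` with `M` right cancellative, `l((A, a))` is generated by `((A, 1), (∅, 1))`. -/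
theorem SSP.lAnn_eq_leftCongGen {M : Type*} [Monoid M]
    (hc : ∀ u v a : M, u * a = v * a → u = v) (A : Set M) (a : M) :
    lAnn (SSP.mk A a) = leftCongGen {(SSP.mk A 1, SSP.mk ∅ 1)} := by
  funext u v
  refine propext ⟨fun h r hr hW => ?_, fun h => h _ (isLeftCong_lAnn _) ?_⟩
  · have hgen : r (SSP.mk A 1) 1 := hW _ rfl
    have hmul (w : SSP M) : r (w * SSP.mk A 1) w := by
      simpa only [mul_one] using hr.2 _ _ w hgen
    simp only [lAnn, SSP.mul_def, SSP.mk.injEq] at h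
    have heq : u * SSP.mk A 1 = v * SSP.mk A 1 := by
      simp only [SSP.mul_def, SSP.mk.injEq]
      exact ⟨h.1, by rw [hc _ _ _ h.2]⟩
    exact hr.1.trans (hr.1.symm (hmul u)) (heq ▸ hmul v)
  · rintro _ rfl
    simp [lAnn, SSP.mul_def]

theorem stmt18 (M : Type*) [Monoid M] (hc : ∀ u v a : M, u * a = v * a → u = v) :
    (∀ (A : Set M) (a : M),
        lAnn (SSP.mk A a) = leftCongGen {(SSP.mk A 1, SSP.mk ∅ 1)}) ∧
    FinitelyLeftEquated (SSP M) := by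
  refine ⟨SSP.lAnn_eq_leftCongGen hc, fun s => ?_⟩
  exact ⟨_, Set.finite_singleton _, SSP.lAnn_eq_leftCongGen hc s.carrier s.elt⟩
end
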